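/- For positive integers $\mu_1,\mu_2$ let $d=\mu_1+\mu_2$ and let $\sigma_{(\mu_1,\mu_2)}=(1\,\cdots\,\mu_1)(\mu_1+1\,\cdots\,\mu_1+\mu_2)\in S_d$. For a transposition $\tau=(a\ b)\in S_d$ with $a<b$ put $\mathrm{top}(\tau)=b$. Let $\nu_1,\nu_2$ be positive integers with $\nu_1+\nu_2=d$, and suppose $\mu_1<\nu_1$, $\mu_1<\nu_2$, $\nu_1<\mu_2$, $\nu_2<\mu_2$. Let $M_{2,0,0;(\mu_1,\mu_2),(\nu_1,\nu_2)}$ be the number of tuples $(\tau_1,\tau_2,\sigma_2,(B_1,B_2))$ such that $\tau_1,\tau_2\in S_d$ are transpositions with $\mathrm{top}(\tau_1)\le\mathrm{top}(\tau_2)$, $\sigma_2\in S_d$ satisfies $\sigma_2\,\tau_2\,\tau_1\,\sigma_{(\mu_1,\mu_2)}=\mathrm{id}$, the subgroup generated by $\sigma_{(\mu_1,\mu_2)},\tau_1,\tau_2,\sigma_2$ acts transitively on $\{1,\dots,d\}$, and $(B_1,B_2)$ is an ordered list of the orbits of $\sigma_2$ on $\{1,\dots,d\}$ with $|B_1|=\nu_1$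 and $|B_2|=\nu_2$. Then $$M_{2,0,0;(\mu_1,\mu_2),(\nu_1,\nu_2)}=\mu_1\,\mu_2\,(\mu_2+1).$$ -/

import Mathlib

/-- The larger moved point of a transposition of `Fin d` (as a natural number):
the supremum of the values in its support. -/
def permTop {d : ℕ} (τ : Equiv.Perm (Fin d)) : ℕ := τ.support.sup Fin.val

/-- The `(p,q)`-monotonicity condition on a tuple `(τ₁,…,τ_b)` of transpositions
(indexed here by `Fin b`, with index `i` corresponding to `τ_{i+1}`):
`top τ_k ≤ top τ_{k+1}` for `1 ≤ k ≤ p-1` and `top τ_k < top τ_{k+1}` for `p ≤ k ≤ p+q-1`. -/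
def MonCond {d b : ℕ} (p q : ℕ) (τ : Fin b → Equiv.Perm (Fin d)) : Prop :=
  ∀ i j : Fin b, (j : ℕ) = (i : ℕ) + 1 →
    ((i : ℕ) + 1 < p → permTop (τ i) ≤ permTop (τ j)) ∧
    (p ≤ (i : ℕ) + 1 → (i : ℕ) + 1 < p + q → permTop (τ i) < permTop (τ j))

/-- The permutation `σ_μ = (1 … μ₁)(μ₁+1 … μ₁+μ₂)⋯` of `{1,…,d}`, `d = μ₁+⋯+μ_m`, with
`{1,…,d}` represented 0-indexed by `Fin d`: `finSigmaFinEquiv` lists the blocks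
`Fin μ₁, Fin μ₂, …` consecutively, and each block is rotated by `k ↦ k+1`. -/
def blockCycle {m : ℕ} (μ : Fin m → ℕ) : Equiv.Perm (Fin (∑ i, μ i)) :=
  finSigmaFinEquiv.permCongr (Equiv.sigmaCongrRight fun i => finRotate (μ i))

/-- `B` is an ordered list of the orbits of `σ` on `{1,…,d}` with `|B_j| = ν_j`:
each `B_j` is an orbit (i.e. a cycle, possibly a fixed point), the `B_j` are
pairwise distinct, every point lies in some `B_j`, and `B_j` has `ν_j` elements. -/
def IsOrbitListing {d n : ℕ} (σ : Equiv.Perm (Fin d)) (ν : Fin n → ℕ)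
    (B : Fin n → Set (Fin d)) : Prop :=
  (∀ j, ∃ x : Fin d, B j = {y | σ.SameCycle x y}) ∧
  Function.Injective B ∧
  (∀ x : Fin d, ∃ j, x ∈ B j) ∧
  (∀ j, (B j).ncard = ν j)

/-- `M_{p,q,r;μ,ν}`: the number of tuples `(τ₁,…,τ_b, σ₂, (B₁,…,B_n))`, `b = p+q+r`, where each
`τᵢ` is a transposition, `(τ₁,…,τ_b)` satisfies the `(p,q)`-monotonicity condition,
`σ₂·τ_b⋯τ₁·σ_μ = id`, the subgroup generated by `σ_μ, τ₁,…,τ_b, σ₂` acts transitively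
on `{1,…,d}`, and `(B₁,…,B_n)` is an ordered list of the orbits of `σ₂` with
`|B_j| = ν_j`. -/
noncomputable def Mcount {m n : ℕ} (p q r : ℕ) (μ : Fin m → ℕ) (ν : Fin n → ℕ) : ℕ :=
  Nat.card { t : (Fin (p + q + r) → Equiv.Perm (Fin (∑ i, μ i))) ×
      Equiv.Perm (Fin (∑ i, μ i)) × (Fin n → Set (Fin (∑ i, μ i))) //
    (∀ i, (t.1 i).IsSwap) ∧ MonCond p q t.1 ∧
    t.2.1 * (List.ofFn t.1).reverse.prod * blockCycle μ = 1 ∧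
    (∀ x y : Fin (∑ i, μ i), ∃ g ∈ Subgroup.closure
        ({blockCycle μ, t.2.1} ∪ Set.range t.1 : Set (Equiv.Perm (Fin (∑ i, μ i)))), g x = y) ∧
    IsOrbitListing t.2.1 ν t.2.2 }

open Equiv Equiv.Perm

theorem sameCycle_iff_exists_pow_lt {α : Type*} {f : Perm α} {x : α} {k : ℕ} (hk : 0 < k)
    (h : (f ^ k) x = x) (z : α) : f.SameCycle x z ↔ ∃ i < k, (f ^ i) x = z := by
  constructor
  · rintro ⟨n, rfl⟩
    have hk' : (k : ℤ) ≠ 0 := by exact_mod_cast hk.ne'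
    refine ⟨(n % k).toNat, ?_, ?_⟩
    · have := Int.emod_lt_of_pos n (by exact_mod_cast hk : (0 : ℤ) < k)
      have := Int.emod_nonneg n hk'
      omega
    · have h1 : ((n % k).toNat : ℤ) = n % k := Int.toNat_of_nonneg (Int.emod_nonneg n hk')
      have h2 : (f ^ (n % k)) x = (f ^ n) x := by
        conv_rhs => rw [← Int.emod_add_mul_ediv n k, zpow_add, zpow_mul, Perm.mul_apply]
        have : ((f ^ (k : ℤ)) ^ (n / k)) x = x :=
          zpow_apply_eq_self_of_apply_eq_self (by simpa using h) _
        rw [this]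
      rw [← h2, ← h1, zpow_natCast, h1]
  · rintro ⟨i, -, rfl⟩
    exact ⟨i, by simp⟩

/-- The `k` consecutive points `x, c x, …, c ^ (k - 1) x` of an orbit of `c`. -/
def cycleArc {α : Type*} (c : Perm α) (x : α) (k : ℕ) : Set α := {z | ∃ i < k, (c ^ i) x = z}

section FullCycle

variable {α : Type*} [Fintype α] {c : Perm α}

theorem pow_eq_pow_of_lt_card (hc : c.IsCycleOn (Set.univ : Set α)) {x : α} {i j : ℕ}
    (hi : i < Fintype.card α) (hj : j < Fintype.card α) (h : (c ^ i) x = (c ^ j) x) : i = j := by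
  have hc' : c.IsCycleOn ((Finset.univ : Finset α) : Set α) := by simpa using hc
  have := (hc'.pow_apply_eq_pow_apply (Finset.mem_univ x)).1 h
  rw [Finset.card_univ] at this
  exact Nat.ModEq.eq_of_lt_of_lt this hi hj

theorem pow_card_apply_of_isCycleOn (hc : c.IsCycleOn (Set.univ : Set α)) (x : α) :
    (c ^ Fintype.card α) x = x := by
  have hc' : c.IsCycleOn ((Finset.univ : Finset α) : Set α) := by simpa using hc
  exact hc'.pow_card_apply (Finset.mem_univ x)

theorem exists_pow_lt_card (hc : c.IsCycleOn (Set.univ : Set α)) (x y : α) :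
    ∃ i < Fintype.card α, (c ^ i) x = y :=
  (sameCycle_iff_exists_pow_lt (Fintype.card_pos_iff.2 ⟨x⟩)
    (pow_card_apply_of_isCycleOn hc x) y).1 (hc.2 (Set.mem_univ _) (Set.mem_univ _))

theorem ncard_cycleArc (hc : c.IsCycleOn (Set.univ : Set α)) (x : α) {k : ℕ}
    (hk : k ≤ Fintype.card α) : (cycleArc c x k).ncard = k := by
  have : cycleArc c x k = (fun i => (c ^ i) x) '' (Finset.range k : Set ℕ) := by
    ext z; simp [cycleArc]
  rw [this, Set.InjOn.ncard_image, Set.ncard_coe_finset, Finset.card_range]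
  intro i hi j hj h
  simp only [Finset.coe_range, Set.mem_Iio] at hi hj
  exact pow_eq_pow_of_lt_card hc (hi.trans_le hk) (hj.trans_le hk) h

theorem cycleArc_injective (hc : c.IsCycleOn (Set.univ : Set α)) {k : ℕ} (hk : 0 < k)
    (hk' : k < Fintype.card α) {x y : α} (h : cycleArc c x k = cycleArc c y k) : x = y := by
  have hx : x ∈ cycleArc c y k := h ▸ ⟨0, hk, rfl⟩
  obtain ⟨i, hi, rfl⟩ := hx
  rcases Nat.eq_zero_or_pos i with rfl | hi0
  · rfl
  · have hm : (c ^ k) y ∈ cycleArc c ((c ^ i) y) k :=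
      ⟨k - i, by omega, by rw [← Perm.mul_apply, ← pow_add]; congr 2; omega⟩
    rw [h] at hm
    obtain ⟨j, hj, hjk⟩ := hm
    have := pow_eq_pow_of_lt_card hc (hj.trans hk') hk' hjk
    omega

/-- Multiplying a full cycle by a transposition cuts off the arc between the swapped points. -/
theorem setOf_sameCycle_swap_mul [DecidableEq α] (hc : c.IsCycleOn (Set.univ : Set α)) (x : α)
    {k : ℕ} (hk : 0 < k) (hk' : k < Fintype.card α) :
    {z | (swap x ((c ^ k) x) * c).SameCycle x z} = cycleArc c x k := by
  have key : ∀ i < k, ((swap x ((c ^ k) x) * c) ^ i) x = (c ^ i) x := by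
    intro i
    induction i with
    | zero => simp
    | succ i ih =>
      intro hi
      rw [pow_succ', Perm.mul_apply, ih (by omega), Perm.mul_apply, ← Perm.mul_apply c,
        ← pow_succ']
      refine swap_apply_of_ne_of_ne (fun h => ?_) (fun h => ?_)
      · have := pow_eq_pow_of_lt_card hc (j := 0) (hi.trans hk') (by omega) h
        omega
      · have := pow_eq_pow_of_lt_card hc (hi.trans hk') hk' h
        omega
  have hkx : ((swap x ((c ^ k) x) * c) ^ k) x = x := by
    obtain ⟨i, rfl⟩ : ∃ i, k = i + 1 := ⟨k - 1, by omega⟩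
    rw [pow_succ' (swap _ _ * c), Perm.mul_apply, key i (by omega), Perm.mul_apply,
      ← Perm.mul_apply c, ← pow_succ', swap_apply_right]
  ext z
  rw [Set.mem_ofPred_eq, sameCycle_iff_exists_pow_lt hk hkx]
  exact exists_congr fun i => and_congr_right fun hi => by rw [key i hi]

theorem pow_card_sub_apply (hc : c.IsCycleOn (Set.univ : Set α)) (x : α) {k l : ℕ}
    (hkl : k + l = Fintype.card α) : (c ^ l) ((c ^ k) x) = x := by
  rw [← Perm.mul_apply, ← pow_add, add_comm, hkl, pow_card_apply_of_isCycleOn hc]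

theorem setOf_sameCycle_swap_mul_right [DecidableEq α] (hc : c.IsCycleOn (Set.univ : Set α)) (x : α)
    {k l : ℕ} (hk : 0 < k) (hl : 0 < l) (hkl : k + l = Fintype.card α) :
    {z | (swap x ((c ^ k) x) * c).SameCycle ((c ^ k) x) z} = cycleArc c ((c ^ k) x) l := by
  have := setOf_sameCycle_swap_mul hc ((c ^ k) x) hl (by omega)
  rwa [pow_card_sub_apply hc x hkl, swap_comm] at this

theorem mem_cycleArc_or (hc : c.IsCycleOn (Set.univ : Set α)) (x : α) {k l : ℕ}
    (hkl : k + l = Fintype.card α) (z : α) :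
    z ∈ cycleArc c x k ∨ z ∈ cycleArc c ((c ^ k) x) l := by
  obtain ⟨i, hi, rfl⟩ := exists_pow_lt_card hc x z
  by_cases h : i < k
  · exact Or.inl ⟨i, h, rfl⟩
  · refine Or.inr ⟨i - k, by omega, ?_⟩
    rw [← Perm.mul_apply, ← pow_add]
    congr 2; omega

theorem cycleArc_ne_cycleArc (hc : c.IsCycleOn (Set.univ : Set α)) (x : α) {k l : ℕ}
    (hl : 0 < l) (hkl : k + l = Fintype.card α) :
    cycleArc c x k ≠ cycleArc c ((c ^ k) x) l := by
  intro h
  have hm : (c ^ k) x ∈ cycleArc c x k := h ▸ ⟨0, hl, rfl⟩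
  obtain ⟨j, hj, hjk⟩ := hm
  have := pow_eq_pow_of_lt_card hc (by omega) (by omega) hjk
  omega

end FullCycle

/-- The orbits of a full cycle times a transposition, listed with prescribed sizes. -/
theorem isOrbitListing_swap_mul_cycle {d k l : ℕ} {c : Perm (Fin d)}
    (hc : c.IsCycleOn (Set.univ : Set (Fin d))) (hk : 0 < k) (hl : 0 < l) (hkl : k + l = d)
    (x : Fin d) :
    IsOrbitListing (swap x ((c ^ k) x) * c)⁻¹ ![k, l]
      ![cycleArc c x k, cycleArc c ((c ^ k) x) l] := by
  have hkl' : k + l = Fintype.card (Fin d) := by simpa using hkl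
  have h0 := setOf_sameCycle_swap_mul hc x hk (by omega)
  have h1 := setOf_sameCycle_swap_mul_right hc x hk hl hkl'
  have hne := cycleArc_ne_cycleArc hc x hl hkl'
  refine ⟨?_, ?_, ?_, ?_⟩
  · simp only [sameCycle_inv]
    intro j
    fin_cases j
    · exact ⟨_, h0.symm⟩
    · exact ⟨_, h1.symm⟩
  · intro i j
    fin_cases i <;> fin_cases j <;> simp [hne, hne.symm]
  · intro z
    rcases mem_cycleArc_or hc x hkl' z with h | h
    · exact ⟨0, h⟩
    · exact ⟨1, h⟩
  · intro j
    fin_cases j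
    · exact ncard_cycleArc hc x (by omega)
    · exact ncard_cycleArc hc _ (by omega)

theorem exists_of_isOrbitListing_swap_mul_cycle {d k l : ℕ} {c s : Perm (Fin d)}
    (hc : c.IsCycleOn (Set.univ : Set (Fin d))) (hkl : k + l = d)
    (hs : s.IsSwap) {B : Fin 2 → Set (Fin d)} (hB : IsOrbitListing (s * c)⁻¹ ![k, l] B) :
    ∃ x, s = swap x ((c ^ k) x) ∧ B = ![cycleArc c x k, cycleArc c ((c ^ k) x) l] := by
  obtain ⟨u, v, huv, rfl⟩ := hs
  obtain ⟨m, hm, rfl⟩ := exists_pow_lt_card hc u v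
  have hm0 : 0 < m := by
    rcases Nat.eq_zero_or_pos m with rfl | h
    · exact absurd rfl huv
    · exact h
  obtain ⟨n, hn⟩ : ∃ n, m + n = Fintype.card (Fin d) := ⟨_, Nat.add_sub_cancel' hm.le⟩
  have hn0 : 0 < n := by omega
  have hd : Fintype.card (Fin d) = d := Fintype.card_fin d
  have h0 := setOf_sameCycle_swap_mul hc u hm0 hm
  have h1 := setOf_sameCycle_swap_mul_right hc u hm0 hn0 hn
  obtain ⟨hB1, hB2, -, hB4⟩ := hB
  have hcases : ∀ j, B j = cycleArc c u m ∨ B j = cycleArc c ((c ^ m) u) n := by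
    intro j
    obtain ⟨w, hw⟩ := hB1 j
    simp only [sameCycle_inv] at hw
    have horb : ∀ y, (swap u ((c ^ m) u) * c).SameCycle y w →
        B j = {z | (swap u ((c ^ m) u) * c).SameCycle y z} := by
      intro y hy
      rw [hw]
      ext z
      exact ⟨fun h => hy.trans h, fun h => hy.symm.trans h⟩
    rcases mem_cycleArc_or hc u hn w with h | h
    · left; rw [← h0] at h ⊢; exact horb _ h
    · right; rw [← h1] at h ⊢; exact horb _ h
  have hne : B 0 ≠ B 1 := fun h => absurd (hB2 h) (by decide)
  have hc0 : (B 0).ncard = k := hB4 0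
  have hA := ncard_cycleArc hc u hm.le
  have hA' := ncard_cycleArc hc ((c ^ m) u) (k := n) (by omega)
  rcases hcases 0 with e0 | e0 <;> rcases hcases 1 with e1 | e1
  · exact absurd (e0.trans e1.symm) hne
  · obtain rfl : m = k := by rw [← hA, ← e0, hc0]
    obtain rfl : n = l := by omega
    exact ⟨u, rfl, by ext j; fin_cases j <;> simp [e0, e1]⟩
  · obtain rfl : n = k := by rw [← hA', ← e0, hc0]
    obtain rfl : m = l := by omega
    refine ⟨(c ^ m) u, ?_, ?_⟩
    · rw [pow_card_sub_apply hc u hn, swap_comm]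
    · rw [pow_card_sub_apply hc u hn]
      ext j; fin_cases j <;> simp [e0, e1]
  · exact absurd (e0.trans e1.symm) hne

/-- The successor of `x` in the permutation `(0 … m-1)(m … m+n-1)`. -/
def twoBlockNext (m n x : ℕ) : ℕ :=
  if x < m then (if x + 1 < m then x + 1 else 0) else (if x + 1 < m + n then x + 1 else m)

theorem finRotate_val {k : ℕ} (i : Fin k) :
    (finRotate k i : ℕ) = if (i : ℕ) + 1 < k then (i : ℕ) + 1 else 0 := by
  obtain _ | k := k
  · exact i.elim0
  · rw [coe_finRotate]
    have := i.isLt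
    have : i = Fin.last k ↔ (i : ℕ) = k := by simp [Fin.ext_iff]
    split_ifs <;> omega

theorem blockCycle_pair_apply (m n : ℕ) (x : Fin (∑ i, ![m, n] i)) :
    (blockCycle ![m, n] x : ℕ) = twoBlockNext m n x := by
  obtain ⟨⟨j, k⟩, rfl⟩ := finSigmaFinEquiv.surjective x
  simp only [blockCycle, permCongr_apply, symm_apply_apply, finSigmaFinEquiv_apply,
    sigmaCongrRight_apply]
  have hk := k.isLt
  fin_cases j
  · have hr := finRotate_val (k := m) k
    simp [twoBlockNext] at hk ⊢
    exact hr.trans (by split_ifs <;> omega)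
  · have hr := finRotate_val (k := n) k
    simp [twoBlockNext] at hk ⊢
    exact (congrArg (m + ·) hr).trans (by split_ifs <;> omega)

theorem permTop_swap {d : ℕ} {x y : Fin d} (h : x ≠ y) :
    permTop (swap x y) = max (x : ℕ) y := by
  rw [permTop, support_swap h]
  simp

/-- `τ` maps each of `{0, …, m-1}` and its complement to itself. -/
def PreservesBelow {d : ℕ} (m : ℕ) (τ : Perm (Fin d)) : Prop :=
  ∀ z, (τ z : ℕ) < m ↔ (z : ℕ) < m

theorem preservesBelow_swap {d m : ℕ} {u v : Fin d} :
    PreservesBelow m (swap u v) ↔ ((u : ℕ) < m ↔ (v : ℕ) < m) := by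
  constructor
  · intro h
    simpa using (h u).symm
  · intro h z
    rcases eq_or_ne z u with rfl | hu
    · simpa using h.symm
    rcases eq_or_ne z v with rfl | hv
    · simpa using h
    rw [swap_apply_of_ne_of_ne hu hv]

theorem exists_swap_of_not_preservesBelow {d m : ℕ} {τ : Perm (Fin d)} (hτ : τ.IsSwap)
    (h : ¬ PreservesBelow m τ) : ∃ a b : Fin d, (a : ℕ) < m ∧ m ≤ (b : ℕ) ∧ τ = swap a b := by
  obtain ⟨u, v, -, rfl⟩ := hτ
  rw [preservesBelow_swap] at h
  by_cases hu : (u : ℕ) < m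
  · exact ⟨u, v, hu, by omega, rfl⟩
  · exact ⟨v, u, by omega, by omega, swap_comm _ _⟩

theorem PreservesBelow.mul {d m : ℕ} {f g : Perm (Fin d)} (hf : PreservesBelow m f)
    (hg : PreservesBelow m g) : PreservesBelow m (f * g) :=
  fun z => (hf (g z)).trans (hg z)

theorem PreservesBelow.inv {d m : ℕ} {f : Perm (Fin d)} (hf : PreservesBelow m f) :
    PreservesBelow m f⁻¹ :=
  fun z => by simpa using (hf (f⁻¹ z)).symm

/-- A set of permutations preserving a nontrivial block does not generate a transitive group. -/
theorem exists_not_preservesBelow_of_transitive {d m : ℕ} (hm : 0 < m) (hmd : m < d)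
    {S : Set (Perm (Fin d))} (h : ∀ x y : Fin d, ∃ g ∈ Subgroup.closure S, g x = y) :
    ∃ g ∈ S, ¬ PreservesBelow m g := by
  by_contra! hS
  obtain ⟨g, hg, hgx⟩ := h ⟨0, by omega⟩ ⟨m, hmd⟩
  have hpres : ∀ f ∈ Subgroup.closure S, PreservesBelow m f := by
    intro f hf
    induction hf using Subgroup.closure_induction with
    | mem f hf => exact hS f hf
    | one => exact fun z => Iff.rfl
    | mul f g _ _ hf hg => exact hf.mul hg
    | inv f _ hf => exact hf.inv
  have := hpres g hg ⟨0, by omega⟩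
  rw [hgx] at this
  simp at this
  omega

/-- The point at position `i` on the cycle obtained by joining the blocks `(0 … m-1)` and
`(m … m+n-1)` at `a` and `m + b`, starting from `a`. -/
def joinPos (m n a b i : ℕ) : ℕ :=
  if i < m then (if a + i < m then a + i else a + i - m)
  else (if b + i < m + n then b + i else b + i - n)

/-- The effect on values of the transposition of `u` and `v`. -/
def natSwap (u v z : ℕ) : ℕ := if z = u then v else if z = v then u else z

theorem swap_apply_val {d : ℕ} (u v z : Fin d) : (swap u v z : ℕ) = natSwap u v z := by
  simp only [swap_apply_def, natSwap, ← Fin.ext_iff]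
  split_ifs <;> rfl

section Join

variable {m n d : ℕ} {σ : Perm (Fin d)} {a b : Fin d} {b' : ℕ}

theorem join_pow_apply_val (hd : d = m + n) (hσ : ∀ x, (σ x : ℕ) = twoBlockNext m n x)
    (ha : (a : ℕ) < m) (hb : (b : ℕ) = m + b') {i : ℕ} (hi : i < d) :
    (((swap a b * σ) ^ i) a : ℕ) = joinPos m n a b' i := by
  have hbd := b.isLt
  induction i with
  | zero => simp [joinPos, ha, (Nat.zero_le _).trans_lt ha]
  | succ i ih =>
    rw [pow_succ', Perm.mul_apply, Perm.mul_apply, swap_apply_val, hσ, ih (by omega), hb]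
    simp only [natSwap, twoBlockNext, joinPos]
    split_ifs <;> omega

theorem exists_joinPos_eq {a z : ℕ} (ha : a < m) (hb : b' < n) (hz : z < m + n) :
    ∃ i < m + n, joinPos m n a b' i = z := by
  simp only [joinPos]
  by_cases h : z < m
  · by_cases h' : a ≤ z
    · exact ⟨z - a, by omega, by split_ifs <;> omega⟩
    · exact ⟨z + m - a, by omega, by split_ifs <;> omega⟩
  · by_cases h' : m + b' ≤ z
    · exact ⟨z - b', by omega, by split_ifs <;> omega⟩
    · exact ⟨z + n - b', by omega, by split_ifs <;> omega⟩

theorem join_isCycleOn_univ (hd : d = m + n) (hσ : ∀ x, (σ x : ℕ) = twoBlockNext m n x)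
    (ha : (a : ℕ) < m) (hb : (b : ℕ) = m + b') :
    (swap a b * σ).IsCycleOn (Set.univ : Set (Fin d)) := by
  have hbd := b.isLt
  have h : ∀ z, (swap a b * σ).SameCycle a z := by
    intro z
    obtain ⟨i, hi, hz⟩ := exists_joinPos_eq (b' := b') (n := n) ha (by omega)
      (show (z : ℕ) < m + n by omega)
    refine ⟨i, Fin.ext ?_⟩
    rw [zpow_natCast, join_pow_apply_val hd hσ ha hb (by omega), hz]
  exact ⟨Set.bijOn_univ.2 (Equiv.bijective _), fun x _ y _ => (h x).symm.trans (h y)⟩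

end Join

/-- The position reached from `i` by advancing `k` steps on a cycle of length `k + l`. -/
def advance (k l i : ℕ) : ℕ := if i < l then i + k else i - l

/-- The offsets `b` and positions `i` for which cutting the joined cycle at `i` occurs in no
monotone order of the two transpositions. -/
def IsBadCut (m n k l b i : ℕ) : Prop :=
  (1 ≤ i ∧ i < m ∧ m + n ≤ b + i + k) ∨ (l + 1 ≤ i ∧ i < l + m ∧ m + n ≤ b + i)

instance (m n k l b i : ℕ) : Decidable (IsBadCut m n k l b i) :=
  inferInstanceAs (Decidable (_ ∨ _))

section Arithmetic

variable {m n k l a b i : ℕ}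

theorem joinPos_cases (m n a b i : ℕ) :
    (i < m ∧ a + i < m ∧ joinPos m n a b i = a + i) ∨
    (i < m ∧ m ≤ a + i ∧ joinPos m n a b i = a + i - m) ∨
    (m ≤ i ∧ b + i < m + n ∧ joinPos m n a b i = b + i) ∨
    (m ≤ i ∧ m + n ≤ b + i ∧ joinPos m n a b i = b + i - n) := by
  simp only [joinPos]
  split_ifs <;> omega

theorem natSwap_cases (u v z : ℕ) :
    (z = u ∧ natSwap u v z = v) ∨ (z ≠ u ∧ z = v ∧ natSwap u v z = u) ∨
    (z ≠ u ∧ z ≠ v ∧ natSwap u v z = z) := by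
  simp only [natSwap]
  split_ifs <;> omega

theorem advance_cases (k l i : ℕ) :
    (i < l ∧ advance k l i = i + k) ∨ (l ≤ i ∧ advance k l i = i - l) := by
  simp only [advance]
  split_ifs <;> omega

theorem not_isBadCut_of_le_joinPos (hd : m + n = k + l) (hk : m < k) (hl : m < l)
    (ha : a < m) (hb : b < n) (hi : i < m + n)
    (h : m + b ≤ joinPos m n a b i ∨ m + b ≤ joinPos m n a b (advance k l i)) :
    ¬ IsBadCut m n k l b i := by
  simp only [joinPos, advance, IsBadCut] at *
  split_ifs at h <;> omega

theorem natSwap_joinPos_of_not_isBadCut (hd : m + n = k + l) (hk : m < k) (hl : m < l)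
    (ha : a < m) (hi : i < m + n)
    (h : ¬ IsBadCut m n k l b i) (h1 : joinPos m n a b i < m + b)
    (h2 : joinPos m n a b (advance k l i) < m + b) :
    (m ≤ natSwap a (m + b) (joinPos m n a b i) ∧
      natSwap a (m + b) (joinPos m n a b i) ≤ m + b) ∧
    (m ≤ natSwap a (m + b) (joinPos m n a b (advance k l i)) ∧
      natSwap a (m + b) (joinPos m n a b (advance k l i)) ≤ m + b) := by
  have hj := advance_cases k l i
  have hp := joinPos_cases m n a b i
  have hq := joinPos_cases m n a b (advance k l i)
  have hs := natSwap_cases a (m + b) (joinPos m n a b i)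
  have ht := natSwap_cases a (m + b) (joinPos m n a b (advance k l i))
  generalize natSwap a (m + b) (joinPos m n a b i) = s at *
  generalize natSwap a (m + b) (joinPos m n a b (advance k l i)) = t at *
  generalize joinPos m n a b i = p at *
  generalize joinPos m n a b (advance k l i) = q at *
  generalize advance k l i = j at *
  unfold IsBadCut at *
  rcases hj with hj | hj <;> rcases hp with hp | hp | hp | hp <;> omega

theorem not_isBadCut_of_natSwap_joinPos (hd : m + n = k + l) (hk : m < k) (hl : m < l)
    (ha : a < m) (hb : b < n) (hi : i < m + n)
    (h : natSwap a (m + b) (joinPos m n a b i) < m ↔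
      natSwap a (m + b) (joinPos m n a b (advance k l i)) < m)
    (h1 : natSwap a (m + b) (joinPos m n a b i) ≤ m + b)
    (h2 : natSwap a (m + b) (joinPos m n a b (advance k l i)) ≤ m + b) :
    ¬ IsBadCut m n k l b i ∧ joinPos m n a b i < m + b ∧
      joinPos m n a b (advance k l i) < m + b := by
  have hj := advance_cases k l i
  have hp := joinPos_cases m n a b i
  have hq := joinPos_cases m n a b (advance k l i)
  have hs := natSwap_cases a (m + b) (joinPos m n a b i)
  have ht := natSwap_cases a (m + b) (joinPos m n a b (advance k l i))
  generalize natSwap a (m + b) (joinPos m n a b i) = s at *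
  generalize natSwap a (m + b) (joinPos m n a b (advance k l i)) = t at *
  generalize joinPos m n a b i = p at *
  generalize joinPos m n a b (advance k l i) = q at *
  generalize advance k l i = j at *
  unfold IsBadCut at *
  rcases hj with hj | hj <;> rcases hp with hp | hp | hp | hp <;> omega

theorem card_isBadCut (hd : m + n = k + l) (hk : m < k) (hl : m < l) :
    ((Finset.range n ×ˢ Finset.range (m + n)).filter
      (fun p => IsBadCut m n k l p.1 p.2)).card = (m - 1) * n := by
  have : ((Finset.Ico 1 m) ×ˢ Finset.range n).card = (m - 1) * n := by simp
  rw [← this]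
  clear this
  refine Finset.card_nbij'
    (fun p => if p.2 < m then (p.2, p.1) else (m + l - p.2, n - 1 - p.1))
    (fun q => if m + n ≤ q.2 + q.1 + k then (q.2, q.1) else (n - 1 - q.2, l + m - q.1))
    ?_ ?_ ?_ ?_
  all_goals
    rintro ⟨x, y⟩ h
    simp only [Finset.mem_filter, Finset.mem_product, Finset.mem_range,
      Finset.mem_Ico, Finset.mem_coe] at h ⊢
    try unfold IsBadCut at *
  · split_ifs <;> simp only <;> omega
  · split_ifs <;> simp only <;> omega
  · split_ifs <;> simp only [Prod.mk.injEq] <;> omega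
  · split_ifs <;> simp only [Prod.mk.injEq] <;> omega

end Arithmetic

theorem card_not_isBadCut {m n k l d : ℕ} (hmpos : 0 < m) (hdm : d = m + n) (hd : m + n = k + l)
    (hk : m < k) (hl : m < l) :
    Nat.card {p : Fin m × Fin n × Fin d // ¬ IsBadCut m n k l p.2.1 p.2.2} =
      m * n * (n + 1) := by
  subst hdm
  have e : {p : Fin m × Fin n × Fin (m + n) // ¬ IsBadCut m n k l p.2.1 p.2.2} ≃
      Fin m × {q : Fin n × Fin (m + n) // ¬ IsBadCut m n k l q.1 q.2} :=
    { toFun := fun p => (p.1.1, ⟨p.1.2, p.2⟩)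
      invFun := fun p => ⟨(p.1, p.2.1), p.2.2⟩
      left_inv := fun _ => rfl
      right_inv := fun _ => rfl }
  have hbad : Fintype.card {q : Fin n × Fin (m + n) // IsBadCut m n k l q.1 q.2} =
      (m - 1) * n := by
    rw [← card_isBadCut hd hk hl, Fintype.card_subtype]
    refine Finset.card_bij (fun q _ => ((q.1 : ℕ), (q.2 : ℕ))) ?_ ?_ ?_
    · intro q hq
      simpa using hq
    · rintro ⟨x, y⟩ - ⟨x', y'⟩ - h
      simpa [Fin.ext_iff] using h
    · rintro ⟨x, y⟩ h
      simp only [Finset.mem_filter, Finset.mem_product, Finset.mem_range] at h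
      exact ⟨(⟨x, h.1.1⟩, ⟨y, h.1.2⟩), by simpa using h.2, rfl⟩
  rw [Nat.card_congr e, Nat.card_prod, Nat.card_eq_fintype_card, Nat.card_eq_fintype_card,
    Fintype.card_subtype_compl, hbad, Fintype.card_fin, Fintype.card_prod, Fintype.card_fin,
    Fintype.card_fin, mul_assoc]
  congr 1
  obtain ⟨r, rfl⟩ : ∃ r, m = r + 1 := ⟨m - 1, by omega⟩
  rw [Nat.add_sub_cancel]
  refine Nat.sub_eq_of_eq_add ?_
  ring

/-- The tuples counted by `Mcount 2 0 0` when the first permutation is `σ`. -/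
def IsMonotonePair {d : ℕ} (σ : Perm (Fin d)) (ν : Fin 2 → ℕ)
    (t : (Fin 2 → Perm (Fin d)) × Perm (Fin d) × (Fin 2 → Set (Fin d))) : Prop :=
  (∀ i, (t.1 i).IsSwap) ∧ MonCond 2 0 t.1 ∧
    t.2.1 * (List.ofFn t.1).reverse.prod * σ = 1 ∧
    (∀ x y : Fin d, ∃ g ∈ Subgroup.closure ({σ, t.2.1} ∪ Set.range t.1), g x = y) ∧
    IsOrbitListing t.2.1 ν t.2.2

theorem monCond_two_zero {d : ℕ} {τ : Fin 2 → Perm (Fin d)} :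
    MonCond 2 0 τ ↔ permTop (τ 0) ≤ permTop (τ 1) := by
  simp [MonCond, Fin.forall_fin_two]

theorem isMonotonePair_iff {d : ℕ} {σ : Perm (Fin d)} {ν : Fin 2 → ℕ} {τ : Fin 2 → Perm (Fin d)}
    {ρ : Perm (Fin d)} {B : Fin 2 → Set (Fin d)} :
    IsMonotonePair σ ν (τ, ρ, B) ↔ (τ 0).IsSwap ∧ (τ 1).IsSwap ∧ permTop (τ 0) ≤ permTop (τ 1) ∧
      ρ = (τ 1 * τ 0 * σ)⁻¹ ∧
      (∀ x y : Fin d, ∃ g ∈ Subgroup.closure ({σ, ρ} ∪ Set.range τ), g x = y) ∧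
      IsOrbitListing ρ ν B := by
  simp only [IsMonotonePair, monCond_two_zero, Fin.forall_fin_two, and_assoc]
  have : ρ * (List.ofFn τ).reverse.prod * σ = 1 ↔ ρ = (τ 1 * τ 0 * σ)⁻¹ := by
    rw [eq_inv_iff_mul_eq_one]
    simp [List.ofFn_succ, mul_assoc]
  rw [this]

theorem not_preservesBelow_of_transitive {d m n : ℕ} {σ : Perm (Fin d)} (hm : 0 < m) (hn : 0 < n)
    (hd : d = m + n) (hσ : ∀ x, (σ x : ℕ) = twoBlockNext m n x) {τ : Fin 2 → Perm (Fin d)}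
    (h : ∀ x y : Fin d, ∃ g ∈ Subgroup.closure
      ({σ, (τ 1 * τ 0 * σ)⁻¹} ∪ Set.range τ : Set (Perm (Fin d))), g x = y)
    (h0 : PreservesBelow m (τ 0)) : ¬ PreservesBelow m (τ 1) := by
  intro h1
  have hσ' : PreservesBelow m σ := by
    intro z
    rw [hσ, twoBlockNext]
    split_ifs <;> omega
  obtain ⟨g, hg, hgm⟩ := exists_not_preservesBelow_of_transitive hm (by omega) h
  refine hgm ?_
  rcases hg with (rfl | rfl) | ⟨i, rfl⟩
  · exact hσ'
  · exact ((h1.mul h0).mul hσ').inv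
  · fin_cases i
    · exact h0
    · exact h1

theorem transitive_of_join_mem {d m n b' : ℕ} {σ : Perm (Fin d)} {a b : Fin d}
    (hd : d = m + n) (hσ : ∀ x, (σ x : ℕ) = twoBlockNext m n x)
    (ha : (a : ℕ) < m) (hb : (b : ℕ) = m + b') {S : Set (Perm (Fin d))}
    (hS : σ ∈ S) (hS' : swap a b ∈ S) (x y : Fin d) : ∃ g ∈ Subgroup.closure S, g x = y := by
  obtain ⟨i, -, h⟩ := exists_pow_lt_card (join_isCycleOn_univ hd hσ ha hb) x y
  exact ⟨_, pow_mem (mul_mem (Subgroup.subset_closure hS') (Subgroup.subset_closure hS)) i, h⟩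

theorem swap_eq_swap_of_lt {d m : ℕ} {a b a' b' : Fin d} (ha : (a : ℕ) < m) (hb : m ≤ (b : ℕ))
    (hb' : m ≤ (b' : ℕ)) (h : swap a b = swap a' b') :
    a = a' ∧ b = b' := by
  have hval := congrArg Fin.val (Equiv.congr_fun h a)
  rw [swap_apply_left, swap_apply_val] at hval
  have := natSwap_cases a' b' a
  simp only [Fin.ext_iff]
  omega

section Parametrization

variable {m n k l d : ℕ} (σ : Perm (Fin d)) (k l) (a b : Fin d) (i : ℕ)

/-- The cycle obtained from `σ` by joining two blocks. -/
def joinCycle : Perm (Fin d) := swap a b * σ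

/-- The starting point of the arc cut off at position `i`. -/
def cutStart : Fin d := (joinCycle σ a b ^ i) a

/-- The transposition cutting an arc of length `k` at position `i` off the joined cycle. -/
def cutSwap : Perm (Fin d) :=
  swap (cutStart σ a b i) ((joinCycle σ a b ^ k) (cutStart σ a b i))

/-- The two arcs into which the joined cycle is cut. -/
def cutArcs : Fin 2 → Set (Fin d) :=
  ![cycleArc (joinCycle σ a b) (cutStart σ a b i) k,
    cycleArc (joinCycle σ a b) ((joinCycle σ a b ^ k) (cutStart σ a b i)) l]

/-- The pair of transpositions attached to a join and a cut: join then cut if this is monotone,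
and otherwise the conjugate of the cut followed by the join. -/
def joinCutPair : Fin 2 → Perm (Fin d) :=
  if permTop (swap a b) ≤ permTop (cutSwap σ k a b i) then ![swap a b, cutSwap σ k a b i]
  else ![swap a b * cutSwap σ k a b i * swap a b, swap a b]

/-- The tuple attached to a join and a cut. -/
def joinCutTuple : (Fin 2 → Perm (Fin d)) × Perm (Fin d) × (Fin 2 → Set (Fin d)) :=
  (joinCutPair σ k a b i, (cutSwap σ k a b i * joinCycle σ a b)⁻¹, cutArcs σ k l a b i)

variable {σ k l a b i} {b' : ℕ}

theorem conj_cutSwap : swap a b * cutSwap σ k a b i * swap a b =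
    swap (swap a b (cutStart σ a b i))
      (swap a b ((joinCycle σ a b ^ k) (cutStart σ a b i))) := by
  rw [cutSwap, Equiv.swap_apply_apply, swap_inv]

theorem cutStart_val (hd : d = m + n) (hσ : ∀ x, (σ x : ℕ) = twoBlockNext m n x)
    (ha : (a : ℕ) < m) (hb : (b : ℕ) = m + b') (hi : i < d) :
    (cutStart σ a b i : ℕ) = joinPos m n a b' i :=
  join_pow_apply_val hd hσ ha hb hi

theorem pow_cutStart_val (hd : d = m + n) (hσ : ∀ x, (σ x : ℕ) = twoBlockNext m n x)
    (ha : (a : ℕ) < m) (hb : (b : ℕ) = m + b') (hkl : k + l = d) (hi : i < d) :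
    ((joinCycle σ a b ^ k) (cutStart σ a b i) : ℕ) = joinPos m n a b' (advance k l i) := by
  have hc : (joinCycle σ a b).IsCycleOn (Set.univ : Set (Fin d)) :=
    join_isCycleOn_univ hd hσ ha hb
  have hj := advance_cases k l i
  rw [← join_pow_apply_val hd hσ ha hb (by omega), cutStart, ← Perm.mul_apply, ← pow_add]
  rcases hj with ⟨h, hj⟩ | ⟨h, hj⟩
  · rw [hj, add_comm, joinCycle]
  · have : k + i = advance k l i + d := by omega
    have hp := pow_card_apply_of_isCycleOn hc a
    rw [Fintype.card_fin] at hp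
    rw [this, pow_add, Perm.mul_apply, hp, joinCycle]

theorem pow_cutStart_ne (hd : d = m + n) (hσ : ∀ x, (σ x : ℕ) = twoBlockNext m n x)
    (ha : (a : ℕ) < m) (hb : (b : ℕ) = m + b') (hk : 0 < k) (hkd : k < d) :
    cutStart σ a b i ≠ (joinCycle σ a b ^ k) (cutStart σ a b i) := by
  intro h
  have hc : (joinCycle σ a b).IsCycleOn (Set.univ : Set (Fin d)) :=
    join_isCycleOn_univ hd hσ ha hb
  have := pow_eq_pow_of_lt_card hc (i := 0) (j := k) (by simp; omega) (by simpa using hkd) h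
  omega

theorem permTop_cutSwap (hd : d = m + n) (hσ : ∀ x, (σ x : ℕ) = twoBlockNext m n x)
    (ha : (a : ℕ) < m) (hb : (b : ℕ) = m + b') (hk : 0 < k) (hl : 0 < l) (hkl : k + l = d)
    (hi : i < d) : permTop (cutSwap σ k a b i) =
      max (joinPos m n a b' i) (joinPos m n a b' (advance k l i)) := by
  rw [cutSwap, permTop_swap (pow_cutStart_ne hd hσ ha hb hk (by omega)),
    cutStart_val hd hσ ha hb hi, pow_cutStart_val hd hσ ha hb hkl hi]

theorem permTop_join (ha : (a : ℕ) < m) (hb : (b : ℕ) = m + b') :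
    permTop (swap a b) = m + b' := by
  rw [permTop_swap (fun h => by rw [h] at ha; omega)]
  omega

theorem permTop_conj_cutSwap (hd : d = m + n) (hσ : ∀ x, (σ x : ℕ) = twoBlockNext m n x)
    (ha : (a : ℕ) < m) (hb : (b : ℕ) = m + b') (hk : 0 < k) (hl : 0 < l) (hkl : k + l = d)
    (hi : i < d) : permTop (swap a b * cutSwap σ k a b i * swap a b) =
      max (natSwap a (m + b') (joinPos m n a b' i))
        (natSwap a (m + b') (joinPos m n a b' (advance k l i))) := by
  rw [conj_cutSwap, permTop_swap, swap_apply_val, swap_apply_val,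
    cutStart_val hd hσ ha hb hi, pow_cutStart_val hd hσ ha hb hkl hi, hb]
  exact fun h => pow_cutStart_ne hd hσ ha hb hk (by omega) ((swap a b).injective h)

theorem preservesBelow_conj_cutSwap (hd : d = m + n)
    (hσ : ∀ x, (σ x : ℕ) = twoBlockNext m n x)
    (ha : (a : ℕ) < m) (hb : (b : ℕ) = m + b') (hkl : k + l = d) (hi : i < d) :
    PreservesBelow m (swap a b * cutSwap σ k a b i * swap a b) ↔
      (natSwap a (m + b') (joinPos m n a b' i) < m ↔
        natSwap a (m + b') (joinPos m n a b' (advance k l i)) < m) := by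
  rw [conj_cutSwap, preservesBelow_swap, swap_apply_val, swap_apply_val,
    cutStart_val hd hσ ha hb hi, pow_cutStart_val hd hσ ha hb hkl hi, hb]

theorem not_preservesBelow_join (ha : (a : ℕ) < m) (hb : (b : ℕ) = m + b') :
    ¬ PreservesBelow m (swap a b) := by
  rw [preservesBelow_swap]
  omega

end Parametrization

section Bijection

variable {m n k l d : ℕ} {σ : Perm (Fin d)} {a b : Fin d} {b' i : ℕ}

theorem joinCutPair_mul : joinCutPair σ k a b i 1 * joinCutPair σ k a b i 0 * σ =
    cutSwap σ k a b i * joinCycle σ a b := by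
  unfold joinCutPair
  split_ifs
  · simp [joinCycle, mul_assoc]
  · simp [joinCycle, ← mul_assoc]

theorem isSwap_join (ha : (a : ℕ) < m) (hb : (b : ℕ) = m + b') : (swap a b).IsSwap :=
  ⟨a, b, fun h => by rw [h] at ha; omega, rfl⟩

theorem isSwap_cutSwap (hd : d = m + n) (hσ : ∀ x, (σ x : ℕ) = twoBlockNext m n x)
    (ha : (a : ℕ) < m) (hb : (b : ℕ) = m + b') (hk : 0 < k) (hkd : k < d) :
    (cutSwap σ k a b i).IsSwap :=
  ⟨_, _, pow_cutStart_ne hd hσ ha hb hk hkd, rfl⟩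

theorem isSwap_conj_swap {s : Perm (Fin d)} (hs : s.IsSwap) (a b : Fin d) :
    (swap a b * s * swap a b).IsSwap := by
  obtain ⟨x, y, hxy, rfl⟩ := hs
  refine ⟨swap a b x, swap a b y, fun h => hxy ((swap a b).injective h), ?_⟩
  rw [Equiv.swap_apply_apply, swap_inv]

theorem isMonotonePair_joinCutTuple (hd : d = m + n)
    (hσ : ∀ x, (σ x : ℕ) = twoBlockNext m n x) (hkl : k + l = d) (hk : m < k) (hl : m < l)
    (ha : (a : ℕ) < m) (hb : (b : ℕ) = m + b') (hi : i < d) (hbad : ¬ IsBadCut m n k l b' i) :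
    IsMonotonePair σ ![k, l] (joinCutTuple σ k l a b i) := by
  have hbd := b.isLt
  have hs : (cutSwap σ k a b i).IsSwap := isSwap_cutSwap hd hσ ha hb (by omega) (by omega)
  refine isMonotonePair_iff.2 ⟨?_, ?_, ?_, ?_, ?_, ?_⟩
  · unfold joinCutPair
    split_ifs
    · exact isSwap_join ha hb
    · exact isSwap_conj_swap hs a b
  · unfold joinCutPair
    split_ifs
    · exact hs
    · exact isSwap_join ha hb
  · unfold joinCutPair
    split_ifs with h
    · exact h
    · change permTop (swap a b * cutSwap σ k a b i * swap a b) ≤ permTop (swap a b)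
      rw [permTop_join ha hb, permTop_cutSwap hd hσ ha hb (by omega) (by omega) hkl hi] at h
      rw [permTop_join ha hb, permTop_conj_cutSwap hd hσ ha hb (by omega) (by omega) hkl hi]
      have := natSwap_joinPos_of_not_isBadCut (by omega) hk hl ha (by omega) hbad
        (by omega) (by omega)
      omega
  · rw [joinCutPair_mul]
  · refine transitive_of_join_mem hd hσ ha hb (by simp) (Or.inr ?_)
    unfold joinCutPair
    split_ifs
    · exact ⟨0, rfl⟩
    · exact ⟨1, rfl⟩
  · exact isOrbitListing_swap_mul_cycle (join_isCycleOn_univ hd hσ ha hb) (by omega)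
      (by omega) hkl _

/-- The two cases of `joinCutPair` are told apart by whether the first transposition preserves
the blocks. -/
theorem joinCutPair_preservesBelow_iff (hd : d = m + n)
    (hσ : ∀ x, (σ x : ℕ) = twoBlockNext m n x) (hkl : k + l = d) (hk : m < k) (hl : m < l)
    (ha : (a : ℕ) < m) (hb : (b : ℕ) = m + b') (hi : i < d) (hbad : ¬ IsBadCut m n k l b' i) :
    PreservesBelow m (joinCutPair σ k a b i 0) ↔
      ¬ permTop (swap a b) ≤ permTop (cutSwap σ k a b i) := by
  have hbd := b.isLt
  unfold joinCutPair
  split_ifs with h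
  · simpa [h] using not_preservesBelow_join ha hb
  · simp only [h, not_false_eq_true, iff_true]
    refine (preservesBelow_conj_cutSwap hd hσ ha hb hkl hi).2 ?_
    rw [permTop_join ha hb, permTop_cutSwap hd hσ ha hb (by omega) (by omega) hkl hi] at h
    have := natSwap_joinPos_of_not_isBadCut (by omega) hk hl ha (by omega) hbad
      (by omega) (by omega)
    omega

theorem joinCutTuple_injective (hd : d = m + n)
    (hσ : ∀ x, (σ x : ℕ) = twoBlockNext m n x) (hkl : k + l = d) (hk : m < k) (hl : m < l)
    (ha : (a : ℕ) < m) (hb : (b : ℕ) = m + b') (hi : i < d) (hbad : ¬ IsBadCut m n k l b' i)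
    {a₂ b₂ : Fin d} {b₂' i₂ : ℕ}
    (ha₂ : (a₂ : ℕ) < m) (hb₂ : (b₂ : ℕ) = m + b₂') (hi₂ : i₂ < d)
    (hbad₂ : ¬ IsBadCut m n k l b₂' i₂)
    (h : joinCutTuple σ k l a b i = joinCutTuple σ k l a₂ b₂ i₂) :
    a = a₂ ∧ b = b₂ ∧ i = i₂ := by
  have h0 : joinCutPair σ k a b i = joinCutPair σ k a₂ b₂ i₂ := congrArg Prod.fst h
  have hB : cutArcs σ k l a b i = cutArcs σ k l a₂ b₂ i₂ := congrArg (fun t => t.2.2) h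
  have hiff := joinCutPair_preservesBelow_iff hd hσ hkl hk hl ha hb hi hbad
  rw [h0, joinCutPair_preservesBelow_iff hd hσ hkl hk hl ha₂ hb₂ hi₂ hbad₂, not_iff_not] at hiff
  have hswap : swap a b = swap a₂ b₂ := by
    unfold joinCutPair at h0
    by_cases hle : permTop (swap a b) ≤ permTop (cutSwap σ k a b i)
    · rw [if_pos hle, if_pos (hiff.2 hle)] at h0
      exact congrFun h0 0
    · rw [if_neg hle, if_neg (mt hiff.1 hle)] at h0
      exact congrFun h0 1
  obtain ⟨rfl, rfl⟩ := swap_eq_swap_of_lt ha (by omega) (by omega) hswap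
  have hc : (joinCycle σ a b).IsCycleOn (Set.univ : Set (Fin d)) :=
    join_isCycleOn_univ hd hσ ha hb
  have hx := cycleArc_injective hc (by omega) (by simp; omega) (congrFun hB 0)
  exact ⟨rfl, rfl, pow_eq_pow_of_lt_card hc (by simpa using hi) (by simpa using hi₂) hx⟩

theorem exists_joinCutTuple_eq (hm : 0 < m) (hd : d = m + n)
    (hσ : ∀ x, (σ x : ℕ) = twoBlockNext m n x) (hkl : k + l = d) (hk : m < k) (hl : m < l)
    {t : (Fin 2 → Perm (Fin d)) × Perm (Fin d) × (Fin 2 → Set (Fin d))}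
    (ht : IsMonotonePair σ ![k, l] t) :
    ∃ (a b : Fin d) (b' i : ℕ), (a : ℕ) < m ∧ (b : ℕ) = m + b' ∧ i < d ∧
      ¬ IsBadCut m n k l b' i ∧ joinCutTuple σ k l a b i = t := by
  obtain ⟨τ, ρ, B⟩ := t
  obtain ⟨h0, h1, hle, rfl, htr, hB⟩ := isMonotonePair_iff.1 ht
  have hτ : τ = ![τ 0, τ 1] := by ext j; fin_cases j <;> rfl
  by_cases hp : PreservesBelow m (τ 0)
  · obtain ⟨a, b, ha, hb, hab⟩ := exists_swap_of_not_preservesBelow h1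
      (not_preservesBelow_of_transitive hm (by omega) hd hσ htr hp)
    obtain ⟨b', hb⟩ := Nat.exists_eq_add_of_le hb
    have hbd := b.isLt
    have hc : (joinCycle σ a b).IsCycleOn (Set.univ : Set (Fin d)) :=
      join_isCycleOn_univ hd hσ ha hb
    have hprod : τ 1 * τ 0 * σ = swap a b * τ 0 * swap a b * joinCycle σ a b := by
      rw [hab, joinCycle]
      simp [mul_assoc]
    rw [hprod] at hB
    obtain ⟨x, hx, rfl⟩ := exists_of_isOrbitListing_swap_mul_cycle hc hkl
      (isSwap_conj_swap h0 a b) hB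
    obtain ⟨i, hi, rfl⟩ := exists_pow_lt_card hc a x
    rw [Fintype.card_fin] at hi
    change _ = cutSwap σ k a b i at hx
    have hτ0 : τ 0 = swap a b * cutSwap σ k a b i * swap a b := by
      rw [← hx]
      simp [mul_assoc]
    rw [hτ0, preservesBelow_conj_cutSwap hd hσ ha hb hkl hi] at hp
    rw [hτ0, hab, permTop_join ha hb,
      permTop_conj_cutSwap hd hσ ha hb (by omega) (by omega) hkl hi] at hle
    obtain ⟨hbad, hlt, hlt'⟩ := not_isBadCut_of_natSwap_joinPos (by omega) hk hl ha (by omega)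
      (by omega) hp (by omega) (by omega)
    refine ⟨a, b, b', i, ha, hb, hi, hbad, ?_⟩
    refine Prod.ext ?_ (Prod.ext ?_ rfl)
    · change joinCutPair σ k a b i = τ
      rw [joinCutPair, if_neg, hτ, hτ0, hab]
      rw [permTop_join ha hb, permTop_cutSwap hd hσ ha hb (by omega) (by omega) hkl hi]
      omega
    · change (cutSwap σ k a b i * joinCycle σ a b)⁻¹ = (τ 1 * τ 0 * σ)⁻¹
      rw [hprod, hx]
  · obtain ⟨a, b, ha, hb, hab⟩ := exists_swap_of_not_preservesBelow h0 hp
    obtain ⟨b', hb⟩ := Nat.exists_eq_add_of_le hb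
    have hbd := b.isLt
    have hc : (joinCycle σ a b).IsCycleOn (Set.univ : Set (Fin d)) :=
      join_isCycleOn_univ hd hσ ha hb
    have hprod : τ 1 * τ 0 * σ = τ 1 * joinCycle σ a b := by
      rw [hab, joinCycle, mul_assoc]
    rw [hprod] at hB
    obtain ⟨x, hx, rfl⟩ := exists_of_isOrbitListing_swap_mul_cycle hc hkl h1 hB
    obtain ⟨i, hi, rfl⟩ := exists_pow_lt_card hc a x
    rw [Fintype.card_fin] at hi
    change _ = cutSwap σ k a b i at hx
    rw [hx, hab] at hle
    refine ⟨a, b, b', i, ha, hb, hi, ?_, ?_⟩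
    · rw [permTop_join ha hb,
        permTop_cutSwap hd hσ ha hb (by omega) (by omega) hkl hi] at hle
      exact not_isBadCut_of_le_joinPos (by omega) hk hl ha (by omega) (by omega) (by omega)
    · refine Prod.ext ?_ (Prod.ext ?_ rfl)
      · change joinCutPair σ k a b i = τ
        rw [joinCutPair, if_pos hle, hτ, hx, hab]
      · change (cutSwap σ k a b i * joinCycle σ a b)⁻¹ = (τ 1 * τ 0 * σ)⁻¹
        rw [hprod, hx]

/-- Monotone pairs correspond to joins and cuts that are not bad. -/
theorem card_isMonotonePair (hm : 0 < m) (hd : d = m + n)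
    (hσ : ∀ x, (σ x : ℕ) = twoBlockNext m n x) (hkl : k + l = d) (hk : m < k) (hl : m < l) :
    Nat.card {t // IsMonotonePair σ ![k, l] t} = m * n * (n + 1) := by
  rw [← card_not_isBadCut hm hd (by omega : m + n = k + l) hk hl]
  symm
  let A : Fin m → Fin d := fun x => ⟨x, by omega⟩
  let C : Fin n → Fin d := fun y => ⟨m + y, by omega⟩
  refine Nat.card_eq_of_bijective
    (fun p => ⟨joinCutTuple σ k l (A p.1.1) (C p.1.2.1) p.1.2.2,
      isMonotonePair_joinCutTuple hd hσ hkl hk hl p.1.1.isLt rfl p.1.2.2.isLt p.2⟩) ⟨?_, ?_⟩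
  · rintro ⟨⟨x, y, i⟩, hp⟩ ⟨⟨x₂, y₂, i₂⟩, hp₂⟩ h
    obtain ⟨h1, h2, h3⟩ := joinCutTuple_injective hd hσ hkl hk hl x.isLt rfl i.isLt hp
      x₂.isLt rfl i₂.isLt hp₂ (congrArg Subtype.val h)
    have h1' : (x : ℕ) = x₂ := congrArg (fun z : Fin d => (z : ℕ)) h1
    have h2' : m + (y : ℕ) = m + y₂ := congrArg (fun z : Fin d => (z : ℕ)) h2
    obtain rfl := Fin.ext h1'
    obtain rfl := Fin.ext (Nat.add_left_cancel h2')
    obtain rfl := Fin.ext h3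
    rfl
  · rintro ⟨t, ht⟩
    obtain ⟨a, b, b', i, ha, hb, hi, hbad, rfl⟩ := exists_joinCutTuple_eq hm hd hσ hkl hk hl ht
    have hbd := b.isLt
    refine ⟨⟨(⟨a, ha⟩, ⟨b', by omega⟩, ⟨i, hi⟩), hbad⟩, Subtype.ext ?_⟩
    have hC : C ⟨b', by omega⟩ = b := Fin.ext hb.symm
    change joinCutTuple σ k l a (C ⟨b', by omega⟩) i = _
    rw [hC]

end Bijection

/-- In the chamber `μ₁ < ν₁, μ₁ < ν₂, ν₁ < μ₂, ν₂ < μ₂`, the monotone double Hurwitz count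
`M_{2,0,0;(μ₁,μ₂),(ν₁,ν₂)}` (condition `top τ₁ ≤ top τ₂`) equals `μ₁·μ₂·(μ₂+1)`. -/
theorem strictly_monotone_count_chamberThree
    (μ₁ μ₂ ν₁ ν₂ : ℕ)
    (hμ₁ : 0 < μ₁) (hμ₂ : 0 < μ₂) (hν₁ : 0 < ν₁) (hν₂ : 0 < ν₂)
    (hd : μ₁ + μ₂ = ν₁ + ν₂)
    (c1 : μ₁ < ν₁) (c2 : μ₁ < ν₂) (c3 : ν₁ < μ₂) (c4 : ν₂ < μ₂) :
    Mcount 2 0 0 ![μ₁, μ₂] ![ν₁, ν₂] = μ₁ * μ₂ * (μ₂ + 1) := by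
  have hsum : ∑ i, ![μ₁, μ₂] i = μ₁ + μ₂ := by simp
  exact card_isMonotonePair hμ₁ hsum (blockCycle_pair_apply μ₁ μ₂) (by rw [hsum, hd]) c1 c2
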